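/- For every integer k ≥ 2 there exists a set A ⊆ ℕ such that A contains no 3-term arithmetic progression of distinct elements and D^k(A) is dense in S^{k-1}. -/

import Mathlib

open Set Filter Topology

noncomputable def rho {k : ℕ} (u : Fin k → ℝ) : EuclideanSpace ℝ (Fin k) :=
  ‖((EuclideanSpace.equiv (Fin k) ℝ).symm u : EuclideanSpace ℝ (Fin k))‖⁻¹ •
    ((EuclideanSpace.equiv (Fin k) ℝ).symm u)

def unitSphere (k : ℕ) : Set (EuclideanSpace ℝ (Fin k)) :=
  {x | ‖x‖ = 1 ∧ ∀ i, x i ∈ Icc (0:ℝ) 1}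

def genDir (k : ℕ) (U : Fin k → Set ℕ) : Set (EuclideanSpace ℝ (Fin k)) :=
  {y | ∃ u : Fin k → ℕ, (∀ i, u i ∈ U i) ∧ y = rho (fun i => (u i : ℝ))}

def genDirDistinct (k : ℕ) (U : Fin k → Set ℕ) : Set (EuclideanSpace ℝ (Fin k)) :=
  {y | ∃ u : Fin k → ℕ, (∀ i, u i ∈ U i) ∧ (∀ i j, i ≠ j → u i ≠ u j) ∧
    y = rho (fun i => (u i : ℝ))}

def dirSet (k : ℕ) (A : Set ℕ) : Set (EuclideanSpace ℝ (Fin k)) :=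
  {y | ∃ u : Fin k → ℕ, (∀ i, u i ∈ A) ∧ y = rho (fun i => (u i : ℝ))}

def accSet {α : Type*} [TopologicalSpace α] (Y : Set α) : Set α := {x | AccPt x (𝓟 Y)}

lemma aux_pow (i l j : ℕ) (h : 4 ^ i + 4 ^ l = 2 * 4 ^ j) : i = l := by
  have key : ∀ i l : ℕ, 4 ^ i + 4 ^ l = 2 * 4 ^ j → ¬ i < l := by
    intro i l h hil
    have h1 : 4 ^ i < 4 ^ l := Nat.pow_lt_pow_right (by norm_num) hil
    rcases Nat.lt_or_ge j l with hj | hj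
    · have h2 : 4 ^ (j + 1) ≤ 4 ^ l := Nat.pow_le_pow_right (by norm_num) hj
      rw [pow_succ] at h2
      have : 0 < 4 ^ j := by positivity
      have : 0 < 4 ^ i := by positivity
      omega
    · have h2 : 4 ^ l ≤ 4 ^ j := Nat.pow_le_pow_right (by norm_num) hj
      omega
  have a := key i l h
  have b := key l i (by omega)
  omega

def rr {k : ℕ} (e : ℕ → Fin k → ℕ) (n : ℕ) (i : Fin k) : ℕ :=
  e n i * 4 ^ (k + 1) + 4 ^ (i : ℕ)

def PP {k : ℕ} (e : ℕ → Fin k → ℕ) : ℕ → ℕ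
  | 0 => 1
  | n + 1 => PP e n * (2 * (∑ i, rr e n i) + 1)

lemma rr_pos {k : ℕ} (e : ℕ → Fin k → ℕ) (n : ℕ) (i : Fin k) : 0 < rr e n i := by
  unfold rr; positivity

lemma PP_pos {k : ℕ} (e : ℕ → Fin k → ℕ) (n : ℕ) : 0 < PP e n := by
  induction n with
  | zero => simp [PP]
  | succ n ih => unfold PP; positivity

lemma PP_mono {k : ℕ} (e : ℕ → Fin k → ℕ) : Monotone (PP e) := by
  apply monotone_nat_of_le_succ
  intro n
  rw [PP]
  exact Nat.le_mul_of_pos_right _ (by positivity)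

lemma PP_lt {k : ℕ} (e : ℕ → Fin k → ℕ) {m n : ℕ} (h : m < n) (i : Fin k) :
    2 * (PP e m * rr e m i) < PP e n := by
  refine lt_of_lt_of_le ?_ (PP_mono e h)
  rw [Nat.succ_eq_add_one, PP]
  have h1 : rr e m i ≤ ∑ i, rr e m i :=
    Finset.single_le_sum (f := fun i => rr e m i) (fun _ _ => Nat.zero_le _) (Finset.mem_univ i)
  have := PP_pos e m
  nlinarith

lemma rr_ap {k : ℕ} (e : ℕ → Fin k → ℕ) (n : ℕ) (i l j : Fin k)
    (h : rr e n i + rr e n l = 2 * rr e n j) : i = l := by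
  have hb : ∀ t : Fin k, 4 * 4 ^ (t : ℕ) ≤ 4 ^ k := by
    intro t
    have := Nat.pow_le_pow_right (n := 4) (by norm_num) t.2
    rw [Nat.succ_eq_add_one, pow_succ] at this
    omega
  unfold rr at h
  have hi := hb i
  have hl := hb l
  have hj := hb j
  have h3 : (4 ^ (i : ℕ) + 4 ^ (l : ℕ)) % 4 ^ (k + 1) = (2 * 4 ^ (j : ℕ)) % 4 ^ (k + 1) := by
    have := congrArg (· % 4 ^ (k + 1)) h
    beta_reduce at this
    rw [show e n i * 4 ^ (k + 1) + 4 ^ (i : ℕ) + (e n l * 4 ^ (k + 1) + 4 ^ (l : ℕ)) =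
      4 ^ (i : ℕ) + 4 ^ (l : ℕ) + 4 ^ (k + 1) * (e n i + e n l) by ring,
      show 2 * (e n j * 4 ^ (k + 1) + 4 ^ (j : ℕ)) =
      2 * 4 ^ (j : ℕ) + 4 ^ (k + 1) * (2 * e n j) by ring, Nat.add_mul_mod_self_left,
      Nat.add_mul_mod_self_left] at this
    exact this
  have hp : 0 < 4 ^ k := by positivity
  rw [Nat.mod_eq_of_lt (by rw [pow_succ]; omega), Nat.mod_eq_of_lt (by rw [pow_succ]; omega)] at h3
  exact Fin.ext (aux_pow _ _ _ h3)

/-- the case a < c -/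
lemma no_ap {k : ℕ} (e : ℕ → Fin k → ℕ) (n m p : ℕ) (i j l : Fin k)
    (hac : PP e n * rr e n i < PP e p * rr e p l)
    (h : PP e n * rr e n i + PP e p * rr e p l = 2 * (PP e m * rr e m j)) : False := by
  have hpos : ∀ n i, PP e n ≤ PP e n * rr e n i := fun n i =>
    Nat.le_mul_of_pos_right _ (rr_pos e n i)
  have h1 := hpos n i
  have h2 := hpos m j
  have h3 := hpos p l
  have p1 := PP_pos e n
  rcases lt_trichotomy m p with hmp | rfl | hmp
  · have := PP_lt e hmp j
    omega
  · rcases lt_trichotomy n m with hn | rfl | hn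
    · have hlt := PP_lt e hn i
      have hd : PP e m ∣ PP e n * rr e n i := by
        have : PP e m ∣ PP e n * rr e n i + PP e m * rr e m l := by
          rw [h]; exact ⟨2 * rr e m j, by ring⟩
        exact (Nat.dvd_add_left (Dvd.intro _ rfl)).1 this
      have := Nat.le_of_dvd (by omega) hd
      omega
    · have : rr e n i + rr e n l = 2 * rr e n j := by
        apply Nat.eq_of_mul_eq_mul_left p1
        linarith
      have := rr_ap e n i l j this
      subst this
      omega
    · have := PP_lt e hn l
      omega
  · have := PP_lt e hmp l
    omega

lemma rho_smul {k : ℕ} (c : ℝ) (hc : 0 < c) (u : Fin k → ℝ) : rho (c • u) = rho u := by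
  unfold rho
  rw [map_smul, norm_smul, smul_smul, Real.norm_of_nonneg hc.le]
  congr 1
  rw [mul_inv]
  field_simp

/-- For every k ≥ 2 there is a set A of positive integers containing no
3-term arithmetic progression of distinct elements such that D^k(A) is dense in
S^{k-1}. -/
theorem stmt_9 (k : ℕ) (hk : 2 ≤ k) :
    ∃ A : Set ℕ, (∀ n ∈ A, 0 < n) ∧
      (¬ ∃ a ∈ A, ∃ b ∈ A, ∃ c ∈ A, a ≠ b ∧ b ≠ c ∧ a ≠ c ∧ a + c = 2 * b) ∧
      unitSphere k ⊆ closure (dirSet k A) := by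
  obtain ⟨e, he⟩ := exists_surjective_nat (Fin k → ℕ)
  refine ⟨{a | ∃ n i, a = PP e n * rr e n i}, ?_, ?_, ?_⟩
  · rintro _ ⟨n, i, rfl⟩
    exact Nat.mul_pos (PP_pos e n) (rr_pos e n i)
  · rintro ⟨_, ⟨n, i, rfl⟩, _, ⟨m, j, rfl⟩, _, ⟨p, l, rfl⟩, -, -, hac, h⟩
    rcases lt_or_gt_of_ne hac with hac | hac
    · exact no_ap e n m p i j l hac h
    · exact no_ap e p m n l j i hac (by omega)
  · rintro x ⟨hx, hx0⟩
    choose N hN using fun D : ℕ => he (fun i => ⌊((D : ℝ) + 1) * x i⌋₊)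
    let u : ℕ → Fin k → ℕ := fun D i => PP e (N D) * rr e (N D) i
    let c : ℕ → ℝ := fun D => ((PP e (N D) : ℝ) * 4 ^ (k + 1) * ((D : ℝ) + 1))⁻¹
    have hc : ∀ D, 0 < c D := fun D => by
      have : (0 : ℝ) < PP e (N D) := by exact_mod_cast PP_pos e _
      simp only [c]; positivity
    have hlim : Tendsto (fun D => c D • (fun i => (u D i : ℝ))) atTop (𝓝 (fun i => x i)) := by
      rw [tendsto_pi_nhds]
      intro i
      rw [tendsto_iff_norm_sub_tendsto_zero]
      refine squeeze_zero (fun _ => norm_nonneg _) (fun D => ?_)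
        (tendsto_one_div_add_atTop_nhds_zero_nat (𝕜 := ℝ))
      have hP : (0 : ℝ) < PP e (N D) := by exact_mod_cast PP_pos e _
      have hD : (0 : ℝ) < (D : ℝ) + 1 := by positivity
      have e1 : (c D • (fun i => (u D i : ℝ))) i - x i =
          ((⌊((D : ℝ) + 1) * x i⌋₊ : ℝ) + 4 ^ (i : ℕ) / 4 ^ (k + 1) - ((D : ℝ) + 1) * x i)
            / ((D : ℝ) + 1) := by
        simp only [c, u, rr, hN, Pi.smul_apply, smul_eq_mul]
        push_cast
        field_simp
      rw [e1, Real.norm_eq_abs, abs_div, abs_of_pos hD]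
      gcongr
      have f1 := Nat.floor_le (mul_nonneg hD.le (hx0 i).1)
      have f2 := Nat.lt_floor_add_one (((D : ℝ) + 1) * x i)
      have f3 : (0 : ℝ) ≤ 4 ^ (i : ℕ) / 4 ^ (k + 1) := by positivity
      have f4 : (4 : ℝ) ^ (i : ℕ) / 4 ^ (k + 1) ≤ 1 := by
        rw [div_le_one (by positivity)]
        exact pow_le_pow_right₀ (by norm_num) (by omega)
      rw [abs_le]
      constructor <;> linarith
    have hxx : (EuclideanSpace.equiv (Fin k) ℝ).symm (fun i => x i) = x :=
      (EuclideanSpace.equiv (Fin k) ℝ).symm_apply_apply x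
    have hcont : ContinuousAt (rho (k := k)) (fun i => x i) := by
      unfold rho
      have h0 : Continuous (fun u : Fin k → ℝ => (EuclideanSpace.equiv (Fin k) ℝ).symm u) :=
        (EuclideanSpace.equiv (Fin k) ℝ).symm.continuous
      refine ContinuousAt.smul (ContinuousAt.inv₀ h0.norm.continuousAt ?_) h0.continuousAt
      rw [hxx, hx]; norm_num
    have hrx : rho (fun i => x i) = x := by
      unfold rho
      rw [hxx, hx]; simp
    have ht := hcont.tendsto.comp hlim
    rw [hrx] at ht
    refine mem_closure_of_tendsto ht (Eventually.of_forall fun D => ?_)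
    exact ⟨u D, fun i => ⟨N D, i, rfl⟩, rho_smul _ (hc D) _⟩
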